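/- Let N be a probability measure on ℝ × ℤ/2ℤ whose characteristic function satisfies N̂(s,0) = exp(−σs² + iβs) and N̂(s,1) = κ·exp(−σ's² + iβ's) for all s ∈ ℝ, where either (0 < σ' < σ and 0 < |κ| ≤ √(σ'/σ)·exp(−(β−β')²/(4(σ−σ')))) or (σ' = σ, β = β' and 0 < |κ| ≤ 1). Suppose N = P₁ ∗ P₂ where P₁, P₂ are probability measures on ℝ × ℤ/2ℤ. Then for j = 1, 2 there exist σ_j, σ'_j ≥ 0 and β_j, β'_j, κ_j ∈ ℝ such that P̂_j(s,0) = exp(−σ_j s² + iβ_j s) and P̂_j(s,1) = κ_j·exp(−σ'_j s² + iβ'_j s) for all s ∈ ℝ, where either (0 < σ'_j < σ_j and 0 < |κ_j| ≤ √(σ'_j/σ_j)·exp(−(β_j−β'_j)²/(4(σ_j−σ'_j)))) or (σ'_j = σ_j, β_j = β'_j and 0 < |κ_j| ≤ 1). -/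

import Mathlib

open MeasureTheory Complex

noncomputable section

/-- The characteristic function of a measure on `ℝ × ℤ/2ℤ`, where the character with
parameter `(s, l)` acts on `(t, k)` as `exp(i s t)·(−1)^{l k}`. -/
def charZ2 (μ : Measure (ℝ × ZMod 2)) (s : ℝ) (l : ZMod 2) : ℂ :=
  ∫ p, Complex.exp (Complex.I * s * p.1) * (-1 : ℂ) ^ (l * p.2).val ∂μ

/-- A measure on `ℝ × ℤ/2ℤ` whose characteristic function has the two-piece Gaussian form
with parameters satisfying the admissibility conditions of Lemma 6. -/
def HasAdmissibleGaussForm (P : Measure (ℝ × ZMod 2)) : Prop :=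
  ∃ σ σ' β β' κ : ℝ, 0 ≤ σ ∧ 0 ≤ σ' ∧
    ((0 < σ' ∧ σ' < σ ∧ 0 < |κ| ∧
        |κ| ≤ Real.sqrt (σ' / σ) * Real.exp (-(β - β') ^ 2 / (4 * (σ - σ')))) ∨
      (σ' = σ ∧ β = β' ∧ 0 < |κ| ∧ |κ| ≤ 1)) ∧
    (∀ s : ℝ, charZ2 P s 0 =
      Complex.exp (-(σ : ℂ) * (s : ℂ) ^ 2 + Complex.I * (β : ℂ) * (s : ℂ))) ∧
    (∀ s : ℝ, charZ2 P s 1 = (κ : ℂ) *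
      Complex.exp (-(σ' : ℂ) * (s : ℂ) ^ 2 + Complex.I * (β' : ℂ) * (s : ℂ)))

section

open ProbabilityTheory NNReal

/-- An entire function vanishing at the origin whose real part grows at most quadratically is a
quadratic polynomial. -/
theorem exists_eq_quadratic_of_re_le {g : ℂ → ℂ} (hg : Differentiable ℂ g) (h0 : g 0 = 0)
    {C D : ℝ} (hC : 0 ≤ C) (hD : 0 ≤ D) (hre : ∀ z, (g z).re ≤ C + D * ‖z‖ ^ 2) :
    ∃ a b : ℂ, ∀ z, g z = a * z ^ 2 + b * z := by
  have hbound : ∀ n : ℕ, ∀ R : ℝ, 0 < R →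
      ‖iteratedDeriv n g 0‖ ≤ n.factorial * (2 * (C + D * (2 * R) ^ 2 + 1)) / R ^ n := by
    intro n R hR
    refine norm_iteratedDeriv_le_of_forall_mem_sphere_norm_le n hR hg.diffContOnCl ?_
    intro z hz
    have hz' : ‖z‖ = R := by simpa using hz
    have hBC := borelCaratheodory_zero (f := g) (M := C + D * (2 * R) ^ 2 + 1) (R := 2 * R) (z := z)
      (by positivity) hg.differentiableOn
      (fun w hw ↦ by
        have hw' : ‖w‖ < 2 * R := by simpa using hw
        have : ‖w‖ ^ 2 ≤ (2 * R) ^ 2 := by gcongr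
        have := mul_le_mul_of_nonneg_left this hD
        simp only [Set.mem_ofPred_eq]
        linarith [hre w])
      (by positivity) (by simp [hz', hR]) h0
    rw [hz'] at hBC
    refine hBC.trans_eq ?_
    field_simp
    ring
  have hvanish : ∀ n : ℕ, 3 ≤ n → iteratedDeriv n g 0 = 0 := by
    intro n hn
    set K : ℝ := n.factorial * (2 * (C + 4 * D + 1))
    have hle : ∀ R : ℝ, 1 ≤ R → ‖iteratedDeriv n g 0‖ ≤ K / R := by
      intro R hR
      refine (hbound n R (by positivity)).trans ?_
      rw [div_le_div_iff₀ (by positivity) (by positivity)]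
      have h1 : C + D * (2 * R) ^ 2 + 1 ≤ (C + 4 * D + 1) * R ^ 2 := by
        have : 1 ≤ R ^ 2 := one_le_pow₀ hR
        nlinarith
      have h2 : R ^ 2 * R ≤ R ^ n := by
        rw [← pow_succ]; exact pow_le_pow_right₀ hR hn
      calc (n.factorial * (2 * (C + D * (2 * R) ^ 2 + 1))) * R
          ≤ (n.factorial * (2 * ((C + 4 * D + 1) * R ^ 2))) * R := by gcongr
        _ = K * (R ^ 2 * R) := by simp only [K]; ring
        _ ≤ K * R ^ n := by gcongr
    have hlim : Filter.Tendsto (fun R : ℝ ↦ K / R) Filter.atTop (nhds 0) :=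
      Filter.Tendsto.const_div_atTop Filter.tendsto_id K
    have := ge_of_tendsto hlim (Filter.eventually_atTop.2 ⟨1, hle⟩)
    simpa using this
  refine ⟨iteratedDeriv 2 g 0 / 2, iteratedDeriv 1 g 0, fun z ↦ ?_⟩
  rw [← taylorSeries_eq_of_entire hg 0 z, tsum_eq_sum (s := Finset.range 3)]
  · simp [Finset.sum_range_succ, h0]
    ring
  · intro n hn
    simp [hvanish n (by simpa using hn)]

/-- A nowhere vanishing entire function of order at most two (and of finite type) that is real on
the real axis is the exponential of a real quadratic polynomial, up to a constant. -/
theorem exists_eq_exp_quadratic {f : ℂ → ℂ} (hf : Differentiable ℂ f) (hne : ∀ z, f z ≠ 0)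
    {C D : ℝ} (hD : 0 ≤ D)
    (hgrowth : ∀ z, ‖f z‖ ≤ Real.exp (C + D * ‖z‖ ^ 2))
    (hconj : ∀ z, f (starRingEnd ℂ z) = starRingEnd ℂ (f z)) :
    ∃ a b : ℝ, ∀ z, f z = f 0 * exp (a * z ^ 2 + b * z) := by
  have hlog : Differentiable ℂ (fun z ↦ deriv f z / f z) := hf.deriv.div hf hne
  obtain ⟨g, hg0, hg⟩ := hlog.isExactOn_univ.with_val_at 0 0
  replace hg : ∀ z, HasDerivAt g (deriv f z / f z) z := fun z ↦ hg z trivial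
  have hfg : ∀ z, f z = f 0 * exp (g z) := by
    intro z
    have hder : ∀ w, HasDerivAt (fun w ↦ f w * exp (-g w)) 0 w := by
      intro w
      refine ((hf w).hasDerivAt.mul (hg w).neg.cexp).congr_deriv ?_
      field_simp [hne w]
      ring
    have := is_const_of_deriv_eq_zero (fun w ↦ (hder w).differentiableAt)
      (fun w ↦ (hder w).deriv) z 0
    simp only [hg0, neg_zero, exp_zero, mul_one] at this
    rw [← this, mul_assoc, ← exp_add]
    simp
  have hf0 : 0 < ‖f 0‖ := norm_pos_iff.2 (hne 0)
  obtain ⟨a, b, hab⟩ := exists_eq_quadratic_of_re_le (fun z ↦ (hg z).differentiableAt) hg0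
    (C := |C - Real.log ‖f 0‖|) (abs_nonneg _) hD (fun z ↦ by
      have h := hgrowth z
      rw [hfg z, norm_mul, norm_exp, ← Real.exp_log hf0, ← Real.exp_add, Real.exp_le_exp] at h
      linarith [le_abs_self (C - Real.log ‖f 0‖)])
  have hquot : ∀ z, deriv f z / f z = 2 * a * z + b := by
    intro z
    have h : HasDerivAt g (2 * a * z + b) z := by
      rw [funext hab]
      refine ((((hasDerivAt_id z).pow 2).const_mul a).add
        ((hasDerivAt_id z).const_mul b)).congr_deriv ?_
      simp
      ring
    exact (hg z).unique h
  have hreal : ∀ x : ℝ, (deriv f x / f x).im = 0 := by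
    intro x
    have h := congrFun (deriv_conj_conj (f := f)) x
    have hff : (starRingEnd ℂ ∘ f ∘ starRingEnd ℂ) = f := by
      ext z; simp [hconj]
    have h2 := hconj x
    rw [hff] at h
    simp only [Function.comp_apply, conj_ofReal] at h h2
    rw [← conj_eq_iff_im, map_div₀, ← h, ← h2]
  have hb : b.im = 0 := by simpa [hquot] using hreal 0
  have ha : a.im = 0 := by simpa [hquot, hb] using hreal 1
  refine ⟨a.re, b.re, fun z ↦ ?_⟩
  rw [hfg z, hab z, show (a.re : ℂ) = a from ext rfl (by simp [ha]),
    show (b.re : ℂ) = b from ext rfl (by simp [hb])]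

/-- If a positive multiple of one Gaussian measure is dominated by another Gaussian measure, then
the two are equal, or the first has the smaller variance and the multiple is at most the infimum
of the ratio of the densities. -/
theorem gaussianReal_param_of_smul_le {m m' : ℝ} {v v' : ℝ≥0} {k : ℝ} (hk : 0 < k)
    (h : ENNReal.ofReal k • gaussianReal m' v' ≤ gaussianReal m v) :
    (0 < v' ∧ v' < v ∧
      k ≤ Real.sqrt (v' / v) * Real.exp (-(m - m') ^ 2 / (2 * ((v : ℝ) - v')))) ∨
    (v' = v ∧ m = m' ∧ k ≤ 1) := by
  have hk1 : k ≤ 1 := by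
    have := h Set.univ
    simpa using this
  have hkne : ENNReal.ofReal k ≠ 0 := by simpa using hk
  have hac : gaussianReal m' v' ≪ gaussianReal m v := fun s hs ↦ by
    have := h s
    rw [hs] at this
    simpa [hkne, hk.not_ge] using this
  rcases eq_or_ne v 0 with rfl | hv
  · right
    rw [gaussianReal_zero_var] at hac
    have h1 : gaussianReal m' v' {m}ᶜ = 0 := hac (by simp)
    have hv' : v' = 0 := by
      by_contra hv'
      have := nullSingletonClass_gaussianReal (μ := m') hv'
      have h2 := prob_compl_eq_zero_iff (μ := gaussianReal m' v') (measurableSet_singleton m)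
      simp [h1] at h2
    subst hv'
    refine ⟨rfl, ?_, hk1⟩
    by_contra hne
    rw [gaussianReal_zero_var] at h1
    simp [Ne.symm hne] at h1
  have hv' : v' ≠ 0 := by
    rintro rfl
    have := nullSingletonClass_gaussianReal (μ := m) hv
    have h1 : gaussianReal m' 0 {m'} = 0 := hac (by simp)
    simp [gaussianReal_zero_var] at h1
  have hdens : (fun x ↦ k * gaussianPDFReal m' v' x) ≤ᵐ[volume] gaussianPDFReal m v := by
    have hle : (fun x ↦ ENNReal.ofReal k * gaussianPDF m' v' x) ≤ᵐ[volume] gaussianPDF m v := by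
      refine ae_le_of_forall_setLIntegral_le_of_sigmaFinite (by fun_prop) fun s hs _ ↦ ?_
      have := h s
      rw [Measure.smul_apply, gaussianReal_apply _ hv', gaussianReal_apply _ hv, smul_eq_mul,
        ← lintegral_const_mul _ (by fun_prop)] at this
      exact this
    filter_upwards [hle] with x hx
    simp only [gaussianPDF] at hx
    rwa [← ENNReal.ofReal_mul hk.le, ENNReal.ofReal_le_ofReal_iff (gaussianPDFReal_nonneg _ _ _)]
      at hx
  have hpt : ∀ x, k * gaussianPDFReal m' v' x ≤ gaussianPDFReal m v x := by
    have hcl : IsClosed {x | k * gaussianPDFReal m' v' x ≤ gaussianPDFReal m v x} :=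
      isClosed_le (by unfold gaussianPDFReal; fun_prop) (by unfold gaussianPDFReal; fun_prop)
    have hd : Dense {x | k * gaussianPDFReal m' v' x ≤ gaussianPDFReal m v x} :=
      Measure.dense_of_ae hdens
    intro x
    have := hcl.closure_eq ▸ hd x
    exact this
  have hvp : (0 : ℝ) < v := by positivity
  have hvp' : (0 : ℝ) < v' := by positivity
  have hratio : ∀ x, k * Real.exp ((x - m) ^ 2 / (2 * v) - (x - m') ^ 2 / (2 * v')) ≤
      Real.sqrt (v' / v) := by
    intro x
    have hx := hpt x
    have e1 : Real.exp (-(x - m) ^ 2 / (2 * v)) * Real.exp ((x - m) ^ 2 / (2 * v)) = 1 := by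
      rw [← Real.exp_add, neg_div]; simp
    have e2 : Real.exp ((x - m) ^ 2 / (2 * v) - (x - m') ^ 2 / (2 * v')) =
        Real.exp (-(x - m') ^ 2 / (2 * v')) * Real.exp ((x - m) ^ 2 / (2 * v)) := by
      rw [← Real.exp_add]; congr 1; ring
    have e3 : Real.sqrt (v' / v) =
        Real.sqrt (2 * Real.pi * v') * (Real.sqrt (2 * Real.pi * v))⁻¹ := by
      rw [← div_eq_mul_inv, ← Real.sqrt_div' _ (by positivity)]
      congr 1
      field_simp
    have hs : Real.sqrt (2 * Real.pi * v') * (Real.sqrt (2 * Real.pi * v'))⁻¹ = 1 :=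
      mul_inv_cancel₀ (by positivity)
    have hr : 0 ≤ Real.sqrt (2 * Real.pi * v') := Real.sqrt_nonneg _
    simp only [gaussianPDFReal] at hx
    rw [e2, e3]
    generalize Real.sqrt (2 * Real.pi * v') = r' at *
    generalize Real.sqrt (2 * Real.pi * v) = r at *
    generalize Real.exp (-(x - m') ^ 2 / (2 * v')) = E' at *
    generalize Real.exp (-(x - m) ^ 2 / (2 * v)) = E at *
    have := mul_le_mul_of_nonneg_left hx (a := r' * Real.exp ((x - m) ^ 2 / (2 * v)))
      (by positivity)
    linear_combination this - k * E' * Real.exp ((x - m) ^ 2 / (2 * v)) * hs + r' * r⁻¹ * e1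
  have hlin : ∀ x, (x - m) ^ 2 / (2 * v) - (x - m') ^ 2 / (2 * v') ≤ Real.sqrt (v' / v) / k := by
    intro x
    rw [le_div_iff₀' hk]
    refine le_trans ?_ (hratio x)
    gcongr
    linarith [Real.add_one_le_exp ((x - m) ^ 2 / (2 * (v : ℝ)) - (x - m') ^ 2 / (2 * v'))]
  set B := Real.sqrt (v' / v) / k
  have hpoly : ∀ x, (x - m) ^ 2 * v' - (x - m') ^ 2 * v ≤ 2 * B * v * v' := by
    intro x
    have := mul_le_mul_of_nonneg_left (hlin x) (a := 2 * (v : ℝ) * v') (by positivity)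
    have e : 2 * (v : ℝ) * v' * ((x - m) ^ 2 / (2 * v) - (x - m') ^ 2 / (2 * v')) =
        (x - m) ^ 2 * v' - (x - m') ^ 2 * v := by field_simp
    rw [e] at this
    linarith
  rcases lt_trichotomy v' v with hlt | heq | hgt
  · left
    refine ⟨by positivity, hlt, ?_⟩
    have hlt' : (0 : ℝ) < v - v' := sub_pos.2 (by exact_mod_cast hlt)
    have hx := hratio ((m' * v - m * v') / (v - v'))
    have e : ((m' * v - m * v') / (v - v') - m) ^ 2 / (2 * (v : ℝ)) -
        ((m' * v - m * v') / (v - v') - m') ^ 2 / (2 * v') =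
        (m - m') ^ 2 / (2 * ((v : ℝ) - v')) := by
      field_simp
      ring
    rw [e] at hx
    rw [neg_div, Real.exp_neg, ← div_eq_mul_inv, le_div_iff₀ (Real.exp_pos _)]
    exact hx
  · right
    refine ⟨heq, ?_, hk1⟩
    subst heq
    by_contra hne
    have hne' : m' - m ≠ 0 := fun h0 ↦ hne (by linarith)
    have := hpoly ((m + m') / 2 + (B * v' + 1) / (m' - m))
    have e : ((m + m') / 2 + (B * v' + 1) / (m' - m) - m) ^ 2 * (v' : ℝ) -
       ((m + m') / 2 + (B * v' + 1) / (m' - m) - m') ^ 2 * v' = 2 * B * v' * v' + 2 * v' := by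
      field_simp
      ring
    linarith
  · exfalso
    have hgt' : (0 : ℝ) < v' - v := sub_pos.2 (by exact_mod_cast hgt)
    have hB : 0 < B := by positivity
    have hQ : ∀ x, (v' - v : ℝ) * x ^ 2 ≤
        2 * B * v * v' + 2 * (m * v' - m' * v) * x - m ^ 2 * v' + m' ^ 2 * v := fun x ↦ by
      linarith [hpoly x]
    have hlim : Filter.Tendsto (fun x : ℝ ↦ ((v' - v : ℝ) * x - 2 * (m * v' - m' * v)) * x)
        Filter.atTop Filter.atTop :=
      (Filter.tendsto_atTop_add_const_right _ (-(2 * (m * v' - m' * v)))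
        (Filter.tendsto_id.const_mul_atTop hgt')).atTop_mul_atTop₀ Filter.tendsto_id
    obtain ⟨x, hx⟩ := (hlim.eventually_gt_atTop
      (2 * B * v * v' - m ^ 2 * v' + m' ^ 2 * v)).exists
    linarith [hQ x]

theorem neg_one_pow_val_mul_add (l a b : ZMod 2) :
    (-1 : ℂ) ^ (l * (a + b)).val = (-1) ^ (l * a).val * (-1) ^ (l * b).val := by
  rw [← pow_add]
  refine neg_one_pow_congr ?_
  revert l a b
  decide

/-- The bilateral Laplace transform of a measure on `ℝ × ℤ/2ℤ`, twisted by a character of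
`ℤ/2ℤ`. -/
def laplaceZ2 (P : Measure (ℝ × ZMod 2)) (z : ℂ) (l : ZMod 2) : ℂ :=
  ∫ p, exp (z * p.1) * (-1 : ℂ) ^ (l * p.2).val ∂P

variable {P P₁ P₂ : Measure (ℝ × ZMod 2)}

theorem measurable_laplaceZ2_integrand (z : ℂ) (l : ZMod 2) :
    Measurable fun p : ℝ × ZMod 2 ↦ exp (z * p.1) * (-1 : ℂ) ^ (l * p.2).val :=
  Measurable.mul (by fun_prop)
    ((measurable_of_countable fun k : ZMod 2 ↦ (-1 : ℂ) ^ (l * k).val).comp measurable_snd)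

theorem norm_laplaceZ2_integrand (z : ℂ) (l : ZMod 2) (p : ℝ × ZMod 2) :
    ‖exp (z * p.1) * (-1 : ℂ) ^ (l * p.2).val‖ = Real.exp (z.re * p.1) := by
  simp [norm_exp]

theorem integrable_laplaceZ2_integrand {z : ℂ} (l : ZMod 2)
    (h : Integrable (fun p ↦ Real.exp (z.re * p.1)) P) :
    Integrable (fun p ↦ exp (z * p.1) * (-1 : ℂ) ^ (l * p.2).val) P :=
  h.mono' (measurable_laplaceZ2_integrand z l).aestronglyMeasurable
    (.of_forall fun p ↦ (norm_laplaceZ2_integrand z l p).le)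

theorem norm_laplaceZ2_le (z : ℂ) (l : ZMod 2) :
    ‖laplaceZ2 P z l‖ ≤ mgf Prod.fst P z.re := by
  refine (norm_integral_le_integral_norm _).trans_eq ?_
  simp_rw [norm_laplaceZ2_integrand]
  rfl

theorem laplaceZ2_zero_right (z : ℂ) : laplaceZ2 P z 0 = complexMGF Prod.fst P z := by
  simp [laplaceZ2, complexMGF]

theorem laplaceZ2_one_right {z : ℂ} (h : Integrable (fun p ↦ Real.exp (z.re * p.1)) P) :
    laplaceZ2 P z 1 = complexMGF Prod.fst (P.restrict (Prod.snd ⁻¹' {0})) z -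
      complexMGF Prod.fst (P.restrict (Prod.snd ⁻¹' {0})ᶜ) z := by
  have hs : MeasurableSet (Prod.snd ⁻¹' {0} : Set (ℝ × ZMod 2)) :=
    measurable_snd (measurableSet_singleton 0)
  rw [laplaceZ2, ← integral_add_compl hs (integrable_laplaceZ2_integrand 1 h), complexMGF,
    complexMGF, sub_eq_add_neg, ← integral_neg]
  congr 1
  · refine setIntegral_congr_fun hs fun p hp ↦ ?_
    have hp0 : p.2 = 0 := hp
    simp [hp0]
  · refine setIntegral_congr_fun hs.compl fun p hp ↦ ?_
    have h01 : ∀ k : ZMod 2, k ≠ 0 → k = 1 := by decide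
    have hp0 : p.2 = 1 := h01 _ hp
    simp [hp0, ZMod.val_one]

theorem differentiable_complexMGF {Ω : Type*} {mΩ : MeasurableSpace Ω} {X : Ω → ℝ} {μ : Measure Ω}
    (h : ∀ x : ℝ, Integrable (fun ω ↦ Real.exp (x * X ω)) μ) :
    Differentiable ℂ (complexMGF X μ) := by
  have huniv : integrableExpSet X μ = Set.univ := Set.eq_univ_of_forall h
  have := differentiableOn_complexMGF (X := X) (μ := μ)
  simpa [huniv, differentiableOn_univ] using this

theorem differentiable_laplaceZ2 (h : ∀ x : ℝ, Integrable (fun p ↦ Real.exp (x * p.1)) P)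
    (l : ZMod 2) : Differentiable ℂ (laplaceZ2 P · l) := by
  have h01 : l = 0 ∨ l = 1 := by revert l; decide
  rcases h01 with rfl | rfl
  · simp_rw [laplaceZ2_zero_right]
    exact differentiable_complexMGF h
  · simp_rw [fun z ↦ laplaceZ2_one_right (h (re z))]
    exact (differentiable_complexMGF fun x ↦ (h x).restrict).sub
      (differentiable_complexMGF fun x ↦ (h x).restrict)

theorem laplaceZ2_conj (z : ℂ) (l : ZMod 2) :
    laplaceZ2 P (starRingEnd ℂ z) l = starRingEnd ℂ (laplaceZ2 P z l) := by
  rw [laplaceZ2, laplaceZ2, ← integral_conj]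
  simp [← exp_conj]

theorem integrable_exp_mul_fst_of_conv [IsProbabilityMeasure P₁] [IsProbabilityMeasure P₂] {x : ℝ}
    (h : Integrable (fun p ↦ Real.exp (x * p.1)) (P₁.conv P₂)) :
    Integrable (fun p ↦ Real.exp (x * p.1)) P₁ ∧ Integrable (fun p ↦ Real.exp (x * p.1)) P₂ := by
  rw [integrable_conv_iff h.aestronglyMeasurable] at h
  simp only [Prod.fst_add, mul_add, Real.exp_add, norm_mul, Real.norm_eq_abs, Real.abs_exp,
    integral_const_mul] at h
  obtain ⟨a, ha⟩ := h.1.exists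
  have h2 : Integrable (fun p ↦ Real.exp (x * p.1)) P₂ := by
    simpa [integrable_const_mul_iff, (Real.exp_pos _).ne'] using ha
  have hpos : ∫ p, Real.exp (x * p.1) ∂P₂ ≠ 0 := (integral_exp_pos h2).ne'
  refine ⟨?_, h2⟩
  simpa [integrable_mul_const_iff, hpos] using h.2

theorem laplaceZ2_conv [IsProbabilityMeasure P₁] [IsProbabilityMeasure P₂] {z : ℂ}
    (h : Integrable (fun p ↦ Real.exp (z.re * p.1)) (P₁.conv P₂)) (l : ZMod 2) :
    laplaceZ2 (P₁.conv P₂) z l = laplaceZ2 P₁ z l * laplaceZ2 P₂ z l := by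
  rw [laplaceZ2, integral_conv (integrable_laplaceZ2_integrand l h)]
  have : ∀ p q : ℝ × ZMod 2, exp (z * ((p + q).1 : ℝ)) * (-1 : ℂ) ^ (l * (p + q).2).val =
      (exp (z * p.1) * (-1 : ℂ) ^ (l * p.2).val) * (exp (z * q.1) * (-1 : ℂ) ^ (l * q.2).val) := by
    intro p q
    rw [Prod.fst_add, Prod.snd_add, neg_one_pow_val_mul_add, ofReal_add, mul_add, exp_add]
    ring
  simp_rw [this, integral_const_mul, integral_mul_const]
  rfl

theorem exp_mean_le_mgf {Ω : Type*} {mΩ : MeasurableSpace Ω} {X : Ω → ℝ} {μ : Measure Ω}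
    [IsProbabilityMeasure μ] (h : ∀ x : ℝ, Integrable (fun ω ↦ Real.exp (x * X ω)) μ) (x : ℝ) :
    Real.exp (x * ∫ ω, X ω ∂μ) ≤ mgf X μ x := by
  have huniv : integrableExpSet X μ = Set.univ := Set.eq_univ_of_forall h
  have hX : Integrable X μ := integrable_of_mem_interior_integrableExpSet (by simp [huniv])
  have := convexOn_exp.map_integral_le (f := fun ω ↦ x * X ω) (μ := μ)
    Real.continuous_exp.continuousOn isClosed_univ (by simp) (hX.const_mul x) (h x)
  rwa [integral_const_mul] at this

theorem integrable_exp_mul_mul_I {ν : Measure ℝ} [IsFiniteMeasure ν] (t : ℝ) :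
    Integrable (fun x : ℝ ↦ exp (t * x * I)) ν := by
  refine Integrable.of_bound (by fun_prop) 1 (.of_forall fun x ↦ ?_)
  rw [← ofReal_mul, norm_exp_ofReal_mul_I]

theorem smul_le_of_charFun_sub_eq {ν₀ ν₁ γ : Measure ℝ} [IsFiniteMeasure ν₀] [IsFiniteMeasure ν₁]
    [IsFiniteMeasure γ] {k : ℝ} (hk : 0 ≤ k)
    (h : ∀ t, charFun ν₀ t - charFun ν₁ t = k * charFun γ t) :
    ENNReal.ofReal k • γ ≤ ν₀ := by
  have heq : ν₀ = ν₁ + k.toNNReal • γ := by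
    refine Measure.ext_of_charFun (funext fun t ↦ ?_)
    have hadd : charFun (ν₁ + k.toNNReal • γ) t = charFun ν₁ t + k * charFun γ t := by
      simp_rw [charFun_apply_real]
      rw [integral_add_measure (integrable_exp_mul_mul_I t) (integrable_exp_mul_mul_I t),
        integral_smul_nnreal_measure, NNReal.smul_def, Real.coe_toNNReal k hk, real_smul]
    rw [hadd, ← h t]
    ring
  rw [heq]
  exact Measure.le_add_left le_rfl

theorem nonneg_of_norm_mul_exp_le_one {c : ℂ} (hc : c ≠ 0) {a b : ℝ}
    (h : ∀ s : ℝ, ‖c * exp (-(a : ℂ) * (s : ℂ) ^ 2 + I * (b : ℂ) * (s : ℂ))‖ ≤ 1) : 0 ≤ a := by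
  by_contra! ha
  have hc' : 0 < ‖c‖ := norm_pos_iff.2 hc
  have hs := h (Real.sqrt (1 / (‖c‖ * -a)))
  have hre : ∀ s : ℝ, (-(a : ℂ) * (s : ℂ) ^ 2 + I * (b : ℂ) * (s : ℂ)).re = -a * s ^ 2 := by
    intro s
    simp [← ofReal_pow]
  have ha' : 0 < -a := neg_pos.2 ha
  rw [norm_mul, norm_exp, hre, Real.sq_sqrt (by positivity)] at hs
  have h1 := Real.add_one_le_exp (-a * (1 / (‖c‖ * -a)))
  have h2 := mul_le_mul_of_nonneg_left h1 hc'.le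
  have h3 : ‖c‖ * (-a * (1 / (‖c‖ * -a)) + 1) = 1 + ‖c‖ := by
    have := ha.ne
    field_simp
  linarith

theorem charZ2_eq_laplaceZ2 (s : ℝ) (l : ZMod 2) : charZ2 P s l = laplaceZ2 P (s * I) l := by
  rw [mul_comm (s : ℂ)]
  rfl

theorem norm_charZ2_le_one [IsProbabilityMeasure P] (s : ℝ) (l : ZMod 2) : ‖charZ2 P s l‖ ≤ 1 := by
  rw [charZ2_eq_laplaceZ2]
  refine (norm_laplaceZ2_le _ l).trans ?_
  simp

theorem charFun_gaussianReal_two_mul {a b : ℝ} (ha : 0 ≤ a) (s : ℝ) :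
    charFun (gaussianReal b (2 * a).toNNReal) s =
      exp (-(a : ℂ) * (s : ℂ) ^ 2 + I * (b : ℂ) * (s : ℂ)) := by
  rw [charFun_gaussianReal, Real.coe_toNNReal _ (by positivity)]
  congr 1
  push_cast
  ring

theorem map_fst_eq_gaussianReal [IsProbabilityMeasure P] {a b : ℝ} (ha : 0 ≤ a)
    (h : ∀ s : ℝ, charZ2 P s 0 = exp (-(a : ℂ) * (s : ℂ) ^ 2 + I * (b : ℂ) * (s : ℂ))) :
    P.map Prod.fst = gaussianReal b (2 * a).toNNReal := by
  have := Measure.isProbabilityMeasure_map (μ := P) measurable_fst.aemeasurable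
  refine Measure.ext_of_charFun (funext fun s ↦ ?_)
  rw [← complexMGF_mul_I measurable_fst.aemeasurable, ← laplaceZ2_zero_right,
    ← charZ2_eq_laplaceZ2, h, charFun_gaussianReal_two_mul ha]

/-- A probability measure on `ℝ × ℤ/2ℤ` whose characteristic function is Gaussian on each of the
two components of the dual group satisfies the admissibility conditions. -/
theorem hasAdmissibleGaussForm_of_charZ2 [IsProbabilityMeasure P] {σ σ' β β' κ : ℝ} (hκ : κ ≠ 0)
    (h0 : ∀ s : ℝ, charZ2 P s 0 = exp (-(σ : ℂ) * (s : ℂ) ^ 2 + I * (β : ℂ) * (s : ℂ)))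
    (h1 : ∀ s : ℝ, charZ2 P s 1 = κ * exp (-(σ' : ℂ) * (s : ℂ) ^ 2 + I * (β' : ℂ) * (s : ℂ))) :
    HasAdmissibleGaussForm P := by
  have hσ : 0 ≤ σ := nonneg_of_norm_mul_exp_le_one one_ne_zero fun s ↦ by
    rw [one_mul, ← h0]; exact norm_charZ2_le_one s 0
  have hσ' : 0 ≤ σ' := nonneg_of_norm_mul_exp_le_one (ofReal_ne_zero.2 hκ) fun s ↦ by
    rw [← h1]; exact norm_charZ2_le_one s 1
  have hfst := map_fst_eq_gaussianReal hσ h0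
  set S : Set (ℝ × ZMod 2) := Prod.snd ⁻¹' {0}
  have hle : ∀ T : Set (ℝ × ZMod 2),
      (P.restrict T).map Prod.fst ≤ gaussianReal β (2 * σ).toNNReal := fun T ↦
    hfst ▸ Measure.map_mono Measure.restrict_le_self measurable_fst
  have hdiff : ∀ s : ℝ, charFun ((P.restrict S).map Prod.fst) s -
      charFun ((P.restrict Sᶜ).map Prod.fst) s =
      κ * charFun (gaussianReal β' (2 * σ').toNNReal) s := by
    intro s
    rw [charFun_gaussianReal_two_mul hσ', ← h1, charZ2_eq_laplaceZ2,
      laplaceZ2_one_right (by simp), complexMGF_mul_I measurable_fst.aemeasurable,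
      complexMGF_mul_I measurable_fst.aemeasurable]
  have hdom : ENNReal.ofReal |κ| • gaussianReal β' (2 * σ').toNNReal ≤
      gaussianReal β (2 * σ).toNNReal := by
    rcases le_total 0 κ with hpos | hneg
    · exact (smul_le_of_charFun_sub_eq (abs_nonneg κ) fun s ↦ by
        rw [abs_of_nonneg hpos, hdiff]).trans (hle S)
    · exact (smul_le_of_charFun_sub_eq (abs_nonneg κ) fun s ↦ by
        rw [abs_of_nonpos hneg, ofReal_neg, neg_mul, ← hdiff, neg_sub]).trans (hle Sᶜ)
  have hκ' : 0 < |κ| := abs_pos.2 hκ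
  refine ⟨σ, σ', β, β', κ, hσ, hσ', ?_, h0, h1⟩
  rcases gaussianReal_param_of_smul_le hκ' hdom with ⟨hv', hlt, hk⟩ | ⟨hv, hm, hk⟩
  · left
    have hσ'pos : 0 < σ' := by simpa using hv'
    have hσlt : σ' < σ := by
      have := (Real.toNNReal_lt_toNNReal_iff_of_nonneg (by positivity)).1 hlt
      linarith
    refine ⟨hσ'pos, hσlt, hκ', ?_⟩
    rw [Real.coe_toNNReal _ (by positivity), Real.coe_toNNReal _ (by positivity),
      mul_div_mul_left _ _ two_ne_zero, ← mul_sub, ← mul_assoc] at hk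
    norm_num at hk ⊢
    exact hk
  · right
    rw [Real.toNNReal_eq_toNNReal_iff (by positivity) (by positivity)] at hv
    exact ⟨by linarith, hm, hκ', hk⟩

/-- An entire function which is Gaussian on the imaginary axis is Gaussian everywhere. -/
theorem eq_exp_quadratic_of_imaginary_axis {f : ℂ → ℂ} (hf : Differentiable ℂ f) {c : ℂ} {a b : ℝ}
    (h : ∀ s : ℝ, f (s * I) = c * exp (-(a : ℂ) * (s : ℂ) ^ 2 + I * (b : ℂ) * (s : ℂ))) (z : ℂ) :
    f z = c * exp (a * z ^ 2 + b * z) := by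
  have hg : Differentiable ℂ fun z : ℂ ↦ c * exp (a * z ^ 2 + b * z) := by fun_prop
  refine congrFun (AnalyticOnNhd.eq_of_frequently_eq (z₀ := 0)
    (hf.differentiableOn.analyticOnNhd isOpen_univ)
    (hg.differentiableOn.analyticOnNhd isOpen_univ) ?_) z
  have hlim : Filter.Tendsto (fun s : ℝ ↦ (s : ℂ) * I) (nhdsWithin 0 {0}ᶜ)
      (nhdsWithin 0 {0}ᶜ) := by
    refine tendsto_nhdsWithin_of_tendsto_nhds_of_eventually_within _ ?_ ?_
    · have : Continuous fun s : ℝ ↦ (s : ℂ) * I := by fun_prop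
      simpa using (this.tendsto 0).mono_left nhdsWithin_le_nhds
    · filter_upwards [self_mem_nhdsWithin] with s hs
      simpa using hs
  refine hlim.frequently (Filter.Eventually.frequently (.of_forall fun s ↦ ?_))
  rw [h]
  congr 2
  linear_combination (-(a : ℂ) * s ^ 2) * I_sq

/-- A convolution factor of a measure whose characteristic function is Gaussian on each of the two
components of the dual group, and not identically zero on either, has the same form. -/
theorem hasAdmissibleGaussForm_of_conv_left [IsProbabilityMeasure P₁] [IsProbabilityMeasure P₂]
    {σ σ' β β' κ : ℝ} (hκ : κ ≠ 0)
    (h0 : ∀ s : ℝ, charZ2 (P₁.conv P₂) s 0 =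
      exp (-(σ : ℂ) * (s : ℂ) ^ 2 + I * (β : ℂ) * (s : ℂ)))
    (h1 : ∀ s : ℝ, charZ2 (P₁.conv P₂) s 1 =
      κ * exp (-(σ' : ℂ) * (s : ℂ) ^ 2 + I * (β' : ℂ) * (s : ℂ))) :
    HasAdmissibleGaussForm P₁ := by
  have hσ : 0 ≤ σ := nonneg_of_norm_mul_exp_le_one one_ne_zero fun s ↦ by
    rw [one_mul, ← h0]; exact norm_charZ2_le_one s 0
  have hfst := map_fst_eq_gaussianReal hσ h0
  have hexp : ∀ x : ℝ, Integrable (fun p ↦ Real.exp (x * p.1)) (P₁.conv P₂) := fun x ↦ by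
    have := integrable_exp_mul_gaussianReal (μ := β) (v := (2 * σ).toNNReal) x
    rw [← hfst] at this
    exact this.comp_measurable measurable_fst
  have hexp₁ := fun x ↦ (integrable_exp_mul_fst_of_conv (hexp x)).1
  have hexp₂ := fun x ↦ (integrable_exp_mul_fst_of_conv (hexp x)).2
  have hprod : ∀ z l, laplaceZ2 (P₁.conv P₂) z l = laplaceZ2 P₁ z l * laplaceZ2 P₂ z l :=
    fun z l ↦ laplaceZ2_conv (hexp _) l
  have hne : ∀ l z, laplaceZ2 P₁ z l ≠ 0 := by
    intro l z
    refine left_ne_zero_of_mul (b := laplaceZ2 P₂ z l) ?_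
    rw [← hprod]
    have h01 : l = 0 ∨ l = 1 := by revert l; decide
    rcases h01 with rfl | rfl
    · rw [eq_exp_quadratic_of_imaginary_axis (c := 1) (a := σ) (b := β)
        (differentiable_laplaceZ2 hexp 0) (fun s ↦ by rw [← charZ2_eq_laplaceZ2, h0, one_mul])]
      simp
    · rw [eq_exp_quadratic_of_imaginary_axis (c := κ) (a := σ') (b := β')
        (differentiable_laplaceZ2 hexp 1) (fun s ↦ by rw [← charZ2_eq_laplaceZ2, h1])]
      simp [hκ]
  set m := ∫ p, p.1 ∂P₂
  have hgrowth : ∀ l z, ‖laplaceZ2 P₁ z l‖ ≤ Real.exp ((β - m) ^ 2 + (σ + 1) * ‖z‖ ^ 2) := by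
    intro l z
    refine (norm_laplaceZ2_le z l).trans ?_
    generalize hx : z.re = x
    have hmul : mgf Prod.fst P₁ x * mgf Prod.fst P₂ x = Real.exp (β * x + σ * x ^ 2) := by
      have h := hprod x 0
      simp only [laplaceZ2_zero_right, complexMGF_ofReal] at h
      rw [mgf_gaussianReal hfst, Real.coe_toNNReal _ (by positivity)] at h
      rw [← ofReal_mul, ofReal_inj] at h
      rw [← h]
      congr 1
      ring
    have hlow := exp_mean_le_mgf hexp₂ x
    have hle : mgf Prod.fst P₁ x * Real.exp (x * m) ≤ Real.exp (β * x + σ * x ^ 2) :=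
      hmul ▸ mul_le_mul_of_nonneg_left hlow mgf_nonneg
    rw [← le_div_iff₀ (Real.exp_pos _), ← Real.exp_sub] at hle
    refine hle.trans (Real.exp_le_exp.2 ?_)
    have hxz : x ^ 2 ≤ ‖z‖ ^ 2 := by
      rw [← hx, ← sq_abs]
      gcongr
      exact abs_re_le_norm z
    have := mul_le_mul_of_nonneg_left hxz (add_nonneg hσ zero_le_one)
    nlinarith [sq_nonneg (β - m - x), sq_nonneg (β - m), sq_nonneg x]
  have hform : ∀ l, ∃ a b : ℝ, ∀ z,
      laplaceZ2 P₁ z l = laplaceZ2 P₁ 0 l * exp (a * z ^ 2 + b * z) :=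
    fun l ↦ exists_eq_exp_quadratic (differentiable_laplaceZ2 hexp₁ l) (hne l)
      (add_nonneg hσ zero_le_one) (hgrowth l) (laplaceZ2_conj · l)
  have hchar : ∀ l, ∃ a b : ℝ, ∀ s : ℝ, charZ2 P₁ s l =
      laplaceZ2 P₁ 0 l * exp (-(a : ℂ) * (s : ℂ) ^ 2 + I * (b : ℂ) * (s : ℂ)) := by
    intro l
    obtain ⟨a, b, hab⟩ := hform l
    refine ⟨a, b, fun s ↦ ?_⟩
    rw [charZ2_eq_laplaceZ2, hab]
    congr 2
    linear_combination ((a : ℂ) * s ^ 2) * I_sq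
  obtain ⟨a, b, hab⟩ := hchar 0
  obtain ⟨a', b', hab'⟩ := hchar 1
  have hreal : ((laplaceZ2 P₁ 0 1).re : ℂ) = laplaceZ2 P₁ 0 1 := by
    rw [← conj_eq_iff_re, ← laplaceZ2_conj, map_zero]
  refine hasAdmissibleGaussForm_of_charZ2 (σ := a) (σ' := a') (β := b) (β' := b')
    (κ := (laplaceZ2 P₁ 0 1).re) ?_ ?_ ?_
  · rw [← ofReal_ne_zero, hreal]
    exact hne 1 0
  · intro s
    rw [hab, laplaceZ2_zero_right, complexMGF, integral_congr_ae (g := fun _ ↦ 1) (by simp)]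
    simp
  · intro s
    rw [hreal, hab']

end

theorem factors_of_piecewise_gaussian_measure_on_real_times_z2
    (σ σ' β β' κ : ℝ)
    (hcond : (0 < σ' ∧ σ' < σ ∧ 0 < |κ| ∧
        |κ| ≤ Real.sqrt (σ' / σ) * Real.exp (-(β - β') ^ 2 / (4 * (σ - σ')))) ∨
      (σ' = σ ∧ β = β' ∧ 0 < |κ| ∧ |κ| ≤ 1))
    (N : Measure (ℝ × ZMod 2)) [IsProbabilityMeasure N]
    (hN0 : ∀ s : ℝ, charZ2 N s 0 =
      Complex.exp (-(σ : ℂ) * (s : ℂ) ^ 2 + Complex.I * (β : ℂ) * (s : ℂ)))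
    (hN1 : ∀ s : ℝ, charZ2 N s 1 = (κ : ℂ) *
      Complex.exp (-(σ' : ℂ) * (s : ℂ) ^ 2 + Complex.I * (β' : ℂ) * (s : ℂ)))
    (P₁ P₂ : Measure (ℝ × ZMod 2)) [IsProbabilityMeasure P₁] [IsProbabilityMeasure P₂]
    (hconv : N = P₁.conv P₂) :
    HasAdmissibleGaussForm P₁ ∧ HasAdmissibleGaussForm P₂ := by
  have hκ : κ ≠ 0 := by
    rcases hcond with ⟨_, _, h, _⟩ | ⟨_, _, h, _⟩ <;> exact abs_pos.1 h
  subst hconv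
  refine ⟨hasAdmissibleGaussForm_of_conv_left hκ hN0 hN1, ?_⟩
  rw [Measure.conv_comm] at hN0 hN1
  exact hasAdmissibleGaussForm_of_conv_left hκ hN0 hN1

end
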